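/- For every a ∈ (0,1] and every integer n ≥ 1, the closed interval [2^{-n}, 2^{-n+1}] is mapped into itself by f_a, and the topological entropy of f_a restricted to this invariant interval equals log(2n+1). In particular f_a has invariant sets of arbitrarily small diameter carrying arbitrarily large entropy, so f_a is not asymptotically h-expansive. -/

import Mathlib

open Set MeasureTheory

/-- The piecewise-affine `b`-branched sawtooth map on `[0,1]`:
`g1 b x = b*x - k` on `[k/b,(k+1)/b]` for `k ∈ {0,…,b-1}` even, and
`g1 b x = (k+1) - b*x` there for `k` odd.  (For `x ∈ [0,1]`, the index
`k = min ⌊b*x⌋ (b-1)` is exactly the branch index; at common endpoints of two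
branches both formulas agree, so this agrees with the piecewise definition.) -/
noncomputable def g1 (b : ℕ) (x : ℝ) : ℝ :=
  let k : ℤ := min ⌊(b : ℝ) * x⌋ ((b : ℤ) - 1)
  if Even k then (b : ℝ) * x - (k : ℝ) else ((k : ℝ) + 1) - (b : ℝ) * x

/-- `g_{a,b} = q_a ∘ g_{1,b} ∘ q_a⁻¹`, where `q_a x = x ^ a` (real power). -/
noncomputable def gab (a : ℝ) (b : ℕ) (x : ℝ) : ℝ := (g1 b (x ^ a⁻¹)) ^ a

/-- For `x ∈ I_n = (2^{-n}, 2^{-n+1}]` (with `n ≥ 1`), `nIdx x = n`. -/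
noncomputable def nIdx (x : ℝ) : ℕ := (⌊Real.logb 2 x⁻¹⌋ + 1).toNat

/-- The map `f_a : [0,1] → [0,1]`: on each interval `I_n = (2^{-n}, 2^{-n+1}]` it is
`A_n⁻¹ ∘ g_{a,2n+1} ∘ A_n`, where `A_n x = 2^n x - 1`, and `f_a 0 = 0`. -/
noncomputable def fa (a : ℝ) (x : ℝ) : ℝ :=
  if x ≤ 0 then 0
  else (gab a (2 * nIdx x + 1) ((2 : ℝ) ^ nIdx x * x - 1) + 1) / (2 : ℝ) ^ nIdx x

/-- The function `ε ↦ h*_T(ε) = sup_{x ∈ [0,1]} h(T; Φ_ε(x))`, where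
`Φ_ε(x) = {y ∈ [0,1] : |T^n x - T^n y| ≤ ε for all n ≥ 0}`. -/
noncomputable def hStar (T : ℝ → ℝ) (ε : ℝ) : EReal :=
  ⨆ x ∈ Set.Icc (0 : ℝ) 1,
    Dynamics.coverEntropy T
      {y ∈ Set.Icc (0 : ℝ) 1 | ∀ n : ℕ, |T^[n] x - T^[n] y| ≤ ε}

/-- `T` (as a self-map of `[0,1]`) is asymptotically `h`-expansive if `h*_T(ε) → 0`
as `ε → 0⁺`. -/
def AsympHExpansive (T : ℝ → ℝ) : Prop :=
  Filter.Tendsto (hStar T) (nhdsWithin 0 (Set.Ioi 0)) (nhds (0 : EReal))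

lemma abs_sub_even_min {t : ℝ} {i : ℤ} (h : |t - 2 * i| ≤ 1) (j : ℤ) :
    |t - 2 * i| ≤ |t - 2 * j| := by
  rcases eq_or_ne i j with rfl | hij
  · rfl
  · have h1 : (1 : ℝ) ≤ |(i : ℝ) - j| := by
      exact_mod_cast Int.one_le_abs (sub_ne_zero.2 hij)
    have h2 : |2 * ((i : ℝ) - j)| ≤ |t - 2 * i| + |t - 2 * j| := by
      have := abs_sub (t - 2 * j) (t - 2 * i)
      rw [show t - 2 * j - (t - 2 * i) = 2 * ((i : ℝ) - j) by ring] at this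
      linarith
    rw [abs_mul, abs_two] at h2
    linarith

lemma g1_eq_abs {b : ℕ} {x : ℝ} (hx : x ∈ Icc (0 : ℝ) 1) :
    ∃ j : ℤ, g1 b x = |b * x - 2 * j| ∧ |b * x - 2 * j| ≤ 1 := by
  have hbx : (b : ℝ) * x ≤ b := mul_le_of_le_one_right (Nat.cast_nonneg b) hx.2
  obtain ⟨k, hk⟩ : ∃ k : ℤ, k = min ⌊(b : ℝ) * x⌋ ((b : ℤ) - 1) := ⟨_, rfl⟩
  have hk0 : (k : ℝ) ≤ b * x ∧ (b : ℝ) * x ≤ k + 1 := by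
    rcases le_total ⌊(b : ℝ) * x⌋ ((b : ℤ) - 1) with h | h
    · rw [min_eq_left h] at hk
      subst hk
      exact ⟨Int.floor_le _, (Int.lt_floor_add_one _).le⟩
    · rw [min_eq_right h] at hk
      have := (Int.le_floor.1 h)
      subst hk
      push_cast at this ⊢
      constructor <;> linarith
  have hg : g1 b x = if Even k then (b : ℝ) * x - (k : ℝ) else ((k : ℝ) + 1) - (b : ℝ) * x := by
    rw [hk]; rfl
  rcases Int.even_or_odd k with he | ho
  · rw [if_pos he] at hg
    obtain ⟨j, hj⟩ := he
    refine ⟨j, ?_⟩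
    have : (b : ℝ) * x - 2 * j = b * x - k := by rw [hj]; push_cast; ring
    rw [this, abs_of_nonneg (by linarith), hg]
    exact ⟨rfl, by linarith⟩
  · rw [if_neg (Int.not_even_iff_odd.2 ho)] at hg
    obtain ⟨j, hj⟩ := ho
    refine ⟨j + 1, ?_⟩
    have : (b : ℝ) * x - 2 * (j + 1 : ℤ) = b * x - (k + 1) := by rw [hj]; push_cast; ring
    rw [this, abs_of_nonpos (by linarith), hg]
    exact ⟨by ring, by linarith⟩

lemma mapsTo_g1 (b : ℕ) : MapsTo (g1 b) (Icc 0 1) (Icc 0 1) := by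
  intro x hx
  obtain ⟨j, hj, hj1⟩ := g1_eq_abs (b := b) hx
  rw [hj]
  exact ⟨abs_nonneg _, hj1⟩

lemma iterate_g1_eq_abs (b m : ℕ) {x : ℝ} (hx : x ∈ Icc (0 : ℝ) 1) :
    ∃ j : ℤ, (g1 b)^[m] x = |(b : ℝ) ^ m * x - 2 * j| ∧ |(b : ℝ) ^ m * x - 2 * j| ≤ 1 := by
  induction m with
  | zero => exact ⟨0, by simp [abs_of_nonneg hx.1], by simpa [abs_of_nonneg hx.1] using hx.2⟩
  | succ m ih =>
    obtain ⟨j, hj, -⟩ := ih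
    obtain ⟨i, hi, hi1⟩ := g1_eq_abs (b := b) ((mapsTo_g1 b).iterate m hx)
    rw [Function.iterate_succ_apply', hi]
    rw [hj] at hi1 ⊢
    rcases abs_choice ((b : ℝ) ^ m * x - 2 * j) with h | h <;> rw [h] at hi1 ⊢
    · refine ⟨b * j + i, ?_⟩
      have : (b : ℝ) ^ (m + 1) * x - 2 * (b * j + i : ℤ)
          = b * ((b : ℝ) ^ m * x - 2 * j) - 2 * i := by push_cast; ring
      rw [this]
      exact ⟨rfl, hi1⟩
    · refine ⟨b * j - i, ?_⟩
      have : (b : ℝ) ^ (m + 1) * x - 2 * (b * j - i : ℤ)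
          = -(b * -((b : ℝ) ^ m * x - 2 * j) - 2 * i) := by push_cast; ring
      rw [this, abs_neg]
      exact ⟨rfl, hi1⟩

lemma iterate_g1_sub_le (b m : ℕ) {x y : ℝ} (hx : x ∈ Icc (0 : ℝ) 1) (hy : y ∈ Icc (0 : ℝ) 1) :
    (g1 b)^[m] x - (g1 b)^[m] y ≤ (b : ℝ) ^ m * |x - y| := by
  obtain ⟨i, hi, hi1⟩ := iterate_g1_eq_abs b m hx
  obtain ⟨j, hj, -⟩ := iterate_g1_eq_abs b m hy
  have h1 := abs_sub_even_min hi1 j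
  have h2 := abs_add_le ((b : ℝ) ^ m * y - 2 * j) ((b : ℝ) ^ m * (x - y))
  rw [show (b : ℝ) ^ m * y - 2 * j + (b : ℝ) ^ m * (x - y) = (b : ℝ) ^ m * x - 2 * j by ring,
    abs_mul _ (x - y), abs_of_nonneg (by positivity : (0 : ℝ) ≤ (b : ℝ) ^ m)] at h2
  rw [hi, hj]
  linarith

lemma abs_iterate_g1_sub_le (b m : ℕ) {x y : ℝ} (hx : x ∈ Icc (0 : ℝ) 1)
    (hy : y ∈ Icc (0 : ℝ) 1) :
    |(g1 b)^[m] x - (g1 b)^[m] y| ≤ (b : ℝ) ^ m * |x - y| := by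
  refine abs_le.2 ⟨?_, iterate_g1_sub_le b m hx hy⟩
  have := iterate_g1_sub_le b m hy hx
  rw [abs_sub_comm] at this
  linarith

lemma div_pow_mem_Icc {b k d : ℕ} (hd : 2 * d + 1 ≤ b ^ k) {x : ℝ} (hx : x ∈ Icc (0 : ℝ) 1) :
    (2 * d + x) / (b : ℝ) ^ k ∈ Icc (0 : ℝ) 1 := by
  have hd' : (2 * d + 1 : ℝ) ≤ (b : ℝ) ^ k := by exact_mod_cast hd
  have hd0 : (0 : ℝ) ≤ d := Nat.cast_nonneg d
  have hB : (0 : ℝ) < (b : ℝ) ^ k := by linarith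
  exact ⟨div_nonneg (by linarith [hx.1]) hB.le, (div_le_one hB).2 (by linarith [hx.2])⟩

lemma iterate_g1_div_pow {b k d : ℕ} (hd : 2 * d + 1 ≤ b ^ k) {x : ℝ}
    (hx : x ∈ Icc (0 : ℝ) 1) :
    (g1 b)^[k] ((2 * d + x) / (b : ℝ) ^ k) = x := by
  have hd' : (2 * d + 1 : ℝ) ≤ (b : ℝ) ^ k := by exact_mod_cast hd
  have hd0 : (0 : ℝ) ≤ d := Nat.cast_nonneg d
  have hB : (b : ℝ) ^ k ≠ 0 := by linarith
  obtain ⟨j, hj, hj1⟩ := iterate_g1_eq_abs b k (div_pow_mem_Icc hd hx)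
  rw [mul_div_cancel₀ _ hB] at hj hj1
  have hx' : |2 * d + x - 2 * ((d : ℤ) : ℝ)| = x := by
    rw [Int.cast_natCast, add_sub_cancel_left, abs_of_nonneg hx.1]
  have h1 := abs_sub_even_min hj1 d
  have h2 := abs_sub_even_min (hx'.trans_le hx.2) j
  rw [hj]
  linarith

lemma exists_separated_g1 (b k m : ℕ) (hk : 0 < k) :
    ∃ s : Finset ℝ, (s : Set ℝ) ⊆ Icc 0 1 ∧ s.card = ((b ^ k + 1) / 2) ^ m ∧
      ∀ x ∈ s, ∀ y ∈ s, x ≠ y →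
        ∃ i < k * m, 1 / (b : ℝ) ^ k ≤ |(g1 b)^[i] x - (g1 b)^[i] y| := by
  classical
  induction m with
  | zero => exact ⟨{0}, by simp, by simp, by simp⟩
  | succ m ih =>
    obtain ⟨s, hs, hcard, hsep⟩ := ih
    have key : ∀ d d' : ℕ, d ≠ d' → ∀ x ∈ s, ∀ y ∈ s,
        (1 : ℝ) ≤ |(2 * d + x) - (2 * d' + y)| := by
      intro d d' hdd x hx y hy
      have h1 : (1 : ℝ) ≤ |(d : ℝ) - d'| := by
        exact_mod_cast Int.one_le_abs (sub_ne_zero.2 (Int.natCast_inj.not.2 hdd))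
      have hx := hs hx
      have hy := hs hy
      rcases le_abs.1 h1 with h | h
      · exact le_abs.2 (.inl (by linarith [hx.1, hy.2]))
      · exact le_abs.2 (.inr (by linarith [hx.2, hy.1]))
    have hdig : ∀ d ∈ Finset.range ((b ^ k + 1) / 2), 2 * d + 1 ≤ b ^ k := by
      intro d hd
      rw [Finset.mem_range] at hd
      omega
    have hBpos : ∀ d ∈ Finset.range ((b ^ k + 1) / 2), 0 < (b : ℝ) ^ k := by
      intro d hd
      have : 0 < b ^ k := by have := hdig d hd; omega
      exact_mod_cast this
    refine ⟨(Finset.range ((b ^ k + 1) / 2) ×ˢ s).image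
      fun p ↦ (2 * (p.1 : ℝ) + p.2) / (b : ℝ) ^ k, ?_, ?_, ?_⟩
    · intro z hz
      simp only [Finset.coe_image, Finset.coe_product, mem_image, mem_prod, Finset.mem_coe] at hz
      obtain ⟨⟨d, x⟩, ⟨hd, hx⟩, rfl⟩ := hz
      exact div_pow_mem_Icc (hdig d hd) (hs hx)
    · rw [Finset.card_image_of_injOn, Finset.card_product, Finset.card_range, hcard, pow_succ']
      rintro ⟨d, x⟩ hp ⟨d', y⟩ hp' h
      simp only [Finset.coe_product, mem_prod, Finset.mem_coe] at hp hp'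
      have h' : 2 * (d : ℝ) + x = 2 * d' + y :=
        (div_left_inj' (hBpos d hp.1).ne').1 h
      by_cases hdd : d = d'
      · subst hdd
        rw [Prod.mk.injEq]
        exact ⟨rfl, by linarith⟩
      · have := key d d' hdd x hp.2 y hp'.2
        rw [h', sub_self, abs_zero] at this
        linarith
    · simp only [Finset.mem_image, Finset.mem_product, Prod.exists]
      rintro _ ⟨d, x, ⟨hd, hx⟩, rfl⟩ _ ⟨d', y, ⟨hd', hy⟩, rfl⟩ hne
      by_cases hdd : d = d'
      · subst hdd
        have hxy : x ≠ y := by rintro rfl; exact hne rfl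
        obtain ⟨i, hi, h⟩ := hsep x hx y hy hxy
        refine ⟨i + k, by rw [mul_add_one]; omega, ?_⟩
        rwa [Function.iterate_add_apply, Function.iterate_add_apply,
          iterate_g1_div_pow (hdig d hd) (hs hx), iterate_g1_div_pow (hdig d hd) (hs hy)]
      · refine ⟨0, by positivity, ?_⟩
        rw [Function.iterate_zero, id, id, ← sub_div, abs_div, abs_of_pos (hBpos d hd)]
        exact div_le_div_of_nonneg_right (key d d' hdd x hx y hy) (hBpos d hd).le

open Dynamics Uniformity ExpGrowth in
lemma log_le_mul_coverEntropy_g1 {b k : ℕ} (hb : 0 < b) (hk : 0 < k) :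
    ENNReal.log (((b ^ k + 1) / 2 : ℕ) : ENNReal) ≤ k * coverEntropy (g1 b) (Icc 0 1) := by
  have hB : (0 : ℝ) < (b : ℝ) ^ k := by positivity
  set U : SetRel ℝ ℝ := {p | dist p.1 p.2 < 1 / (b : ℝ) ^ k / 2}
  have hU : U ∈ 𝓤 ℝ := Metric.dist_mem_uniformity (by positivity)
  have hnet : ∀ m : ℕ, ((((b ^ k + 1) / 2 : ℕ) : ENNReal)) ^ m ≤
      ((netMaxcard (g1 b) (Icc 0 1) U (k * m) : ℕ∞) : ENNReal) := by
    intro m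
    obtain ⟨s, hs, hcard, hsep⟩ := exists_separated_g1 b k m hk
    have : IsDynNetIn (g1 b) (Icc 0 1) U (k * m) s := by
      refine ⟨hs, fun x hx y hy hxy ↦ disjoint_left.2 fun z hzx hzy ↦ ?_⟩
      obtain ⟨i, hi, h⟩ := hsep x hx y hy hxy
      have h1 : dist _ _ < _ := mem_ball_dynEntourage.1 hzx i hi
      have h2 : dist _ _ < _ := mem_ball_dynEntourage.1 hzy i hi
      have h3 := dist_triangle_right ((g1 b)^[i] x) ((g1 b)^[i] y) ((g1 b)^[i] z)
      rw [Real.dist_eq] at h3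
      linarith
    have h := ENat.toENNReal_mono this.card_le_netMaxcard
    rw [hcard] at h
    simpa using h
  have hmono : Monotone fun m : ℕ ↦ ((netMaxcard (g1 b) (Icc 0 1) U m : ℕ∞) : ENNReal) :=
    fun _ _ h ↦ ENat.toENNReal_mono (netMaxcard_monotone_time _ _ _ h)
  calc ENNReal.log (((b ^ k + 1) / 2 : ℕ) : ENNReal)
      = expGrowthSup (fun m ↦ (((b ^ k + 1) / 2 : ℕ) : ENNReal) ^ m) := expGrowthSup_pow.symm
    _ ≤ _ := expGrowthSup_monotone hnet
    _ = k * netEntropyEntourage (g1 b) (Icc 0 1) U := hmono.expGrowthSup_comp_mul hk.ne'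
    _ ≤ k * coverEntropy (g1 b) (Icc 0 1) :=
      mul_le_mul_of_nonneg_left (netEntropyEntourage_le_coverEntropy _ _ hU) (by positivity)

lemma exists_finset_cover_Icc {δ : ℝ} (hδ : 0 < δ) :
    ∃ s : Finset ℝ, (s : Set ℝ) ⊆ Icc 0 1 ∧ (s.card : ℝ) ≤ 1 / δ + 3 ∧
      ∀ x ∈ Icc (0 : ℝ) 1, ∃ y ∈ s, |x - y| < δ := by
  classical
  obtain ⟨N, hN⟩ : ∃ N : ℕ, N = ⌊1 / δ⌋₊ + 1 := ⟨_, rfl⟩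
  have hN1 : 1 / δ < N := by rw [hN]; push_cast; exact Nat.lt_floor_add_one _
  have hN2 : (N : ℝ) ≤ 1 / δ + 1 := by
    rw [hN]; push_cast; linarith [Nat.floor_le (one_div_pos.2 hδ).le]
  have hN0 : (0 : ℝ) < N := (one_div_pos.2 hδ).trans hN1
  have hNδ : 1 / (N : ℝ) < δ := by rwa [one_div_lt hN0 hδ]
  refine ⟨(Finset.range (N + 1)).image fun i : ℕ ↦ (i : ℝ) / N, ?_, ?_, ?_⟩
  · intro z hz
    simp only [Finset.coe_image, mem_image, Finset.mem_coe, Finset.mem_range] at hz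
    obtain ⟨i, hi, rfl⟩ := hz
    refine ⟨by positivity, (div_le_one hN0).2 ?_⟩
    exact_mod_cast Nat.lt_succ_iff.1 hi
  · have : (((Finset.range (N + 1)).image fun i : ℕ ↦ (i : ℝ) / N).card : ℝ) ≤ (N + 1 : ℕ) := by
      exact_mod_cast Finset.card_image_le.trans_eq (Finset.card_range _)
    push_cast at this
    linarith
  · intro x hx
    have hx0 : 0 ≤ x * N := mul_nonneg hx.1 hN0.le
    refine ⟨(⌊x * N⌋₊ : ℝ) / N, Finset.mem_image_of_mem _ (Finset.mem_range.2 ?_), ?_⟩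
    · refine Nat.lt_succ_iff.2 (Nat.floor_le_of_le ?_)
      exact mul_le_of_le_one_left hN0.le hx.2
    · have h1 := Nat.floor_le hx0
      have h2 := Nat.lt_floor_add_one (x * N)
      refine lt_of_le_of_lt ?_ hNδ
      rw [show x - (⌊x * N⌋₊ : ℝ) / N = (x * N - ⌊x * N⌋₊) / N by field_simp, abs_div,
        abs_of_pos hN0]
      refine div_le_div_of_nonneg_right ?_ hN0.le
      rw [abs_of_nonneg (by linarith)]
      linarith

open Dynamics Uniformity ExpGrowth in
lemma coverEntropy_g1_le {b : ℕ} (hb : 0 < b) :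
    coverEntropy (g1 b) (Icc 0 1) ≤ (Real.log b : EReal) := by
  have hb0 : (0 : ℝ) < b := by exact_mod_cast hb
  have hb1 : (1 : ℝ) ≤ b := by exact_mod_cast hb
  refine iSup₂_le fun U hU ↦ ?_
  obtain ⟨ε, hε, hεU⟩ := Metric.mem_uniformity_dist.1 hU
  rw [← ENNReal.log_ofReal_of_pos hb0, ← expGrowthSup_pow]
  refine expGrowthSup_le_of_eventually_le (b := ENNReal.ofReal (1 / ε + 3)) ENNReal.ofReal_ne_top
    (Filter.Eventually.of_forall fun n ↦ ?_)
  have hbn : (0 : ℝ) < (b : ℝ) ^ n := by positivity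
  obtain ⟨s, hs, hcard, hcov⟩ := exists_finset_cover_Icc (div_pos hε hbn)
  have hdyn : IsDynCoverOf (g1 b) (Icc 0 1) U n s := by
    intro x hx
    obtain ⟨y, hy, hxy⟩ := hcov x hx
    refine ⟨y, hy, mem_dynEntourage.2 fun k hk ↦ hεU ?_⟩
    rw [Real.dist_eq]
    calc |(g1 b)^[k] x - (g1 b)^[k] y| ≤ (b : ℝ) ^ k * |x - y| :=
          abs_iterate_g1_sub_le b k hx (hs hy)
      _ ≤ (b : ℝ) ^ n * |x - y| := by gcongr
      _ < ε := by rwa [lt_div_iff₀' hbn] at hxy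
  calc ((coverMincard (g1 b) (Icc 0 1) U n : ℕ∞) : ENNReal) ≤ ((s.card : ℕ∞) : ENNReal) :=
        ENat.toENNReal_mono hdyn.coverMincard_le_card
    _ = ENNReal.ofReal (s.card : ℝ) := by simp
    _ ≤ ENNReal.ofReal ((1 / ε + 3) * (b : ℝ) ^ n) := by
        refine ENNReal.ofReal_le_ofReal (hcard.trans ?_)
        have : (1 : ℝ) ≤ (b : ℝ) ^ n := one_le_pow₀ hb1
        rw [one_div_div, add_mul, one_div_mul_eq_div]
        linarith
    _ = ENNReal.ofReal (1 / ε + 3) * ENNReal.ofReal b ^ n := by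
        rw [ENNReal.ofReal_mul (by positivity), ENNReal.ofReal_pow hb0.le]

open Dynamics in
theorem coverEntropy_g1 {b : ℕ} (hb : 0 < b) :
    coverEntropy (g1 b) (Icc 0 1) = (Real.log b : EReal) := by
  have hb0 : (0 : ℝ) < b := by exact_mod_cast hb
  refine (coverEntropy_g1_le hb).antisymm ?_
  have hle := coverEntropy_g1_le hb
  have hnn : 0 ≤ coverEntropy (g1 b) (Icc 0 1) := coverEntropy_nonneg _ ⟨0, by simp⟩
  have hmul := fun k (hk : 0 < k) ↦ log_le_mul_coverEntropy_g1 hb hk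
  generalize coverEntropy (g1 b) (Icc 0 1) = E at hle hnn hmul
  lift E to ℝ using ⟨(hle.trans_lt (EReal.coe_lt_top _)).ne, (EReal.bot_lt_zero.trans_le hnn).ne'⟩
  have hreal : ∀ k : ℕ, 0 < k → k * Real.log b - Real.log 2 ≤ k * E := by
    intro k hk
    have h := hmul k hk
    have hpos : 0 < (b ^ k + 1) / 2 := by
      have : 0 < b ^ k := by positivity
      omega
    have hpos' : (0 : ℝ) < ((b ^ k + 1) / 2 : ℕ) := by exact_mod_cast hpos
    rw [← ENNReal.ofReal_natCast, ENNReal.log_ofReal_of_pos hpos'] at h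
    have h' : Real.log ((b ^ k + 1) / 2 : ℕ) ≤ k * E := by exact_mod_cast h
    refine le_trans ?_ h'
    rw [← Real.log_pow, ← Real.log_div (by positivity) two_ne_zero]
    refine Real.log_le_log (by positivity) ?_
    have : b ^ k ≤ 2 * ((b ^ k + 1) / 2) := by omega
    have : ((b : ℝ)) ^ k ≤ 2 * ((b ^ k + 1) / 2 : ℕ) := by exact_mod_cast this
    linarith
  rw [EReal.coe_le_coe_iff]
  by_contra! hlt
  obtain ⟨k, hk⟩ := exists_nat_gt (Real.log 2 / (Real.log b - E))
  have hd : 0 < Real.log b - E := sub_pos.2 hlt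
  have hk0 : 0 < k := by
    have : (0 : ℝ) < k := lt_of_le_of_lt (div_nonneg (Real.log_nonneg one_le_two) hd.le) hk
    exact_mod_cast this
  rw [div_lt_iff₀ hd] at hk
  have := hreal k hk0
  linarith

lemma gab_rpow {a : ℝ} (ha : 0 < a) (b : ℕ) {x : ℝ} (hx : 0 ≤ x) :
    gab a b (x ^ a) = g1 b x ^ a := by
  rw [gab, Real.rpow_rpow_inv hx ha.ne']

lemma g1_one {b : ℕ} (hb : Odd b) : g1 b 1 = 1 := by
  have h : min ⌊(b : ℝ) * 1⌋ ((b : ℤ) - 1) = (b : ℤ) - 1 := by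
    rw [mul_one, Int.floor_natCast]
    omega
  have he : Even ((b : ℤ) - 1) := by
    obtain ⟨c, rfl⟩ := hb
    exact ⟨c, by push_cast; ring⟩
  unfold g1
  simp only [h, if_pos he]
  push_cast
  ring

lemma g1_zero {b : ℕ} (hb : 0 < b) : g1 b 0 = 0 := by
  have h : min ⌊(b : ℝ) * 0⌋ ((b : ℤ) - 1) = 0 := by
    rw [mul_zero, Int.floor_zero]
    omega
  unfold g1
  simp only [h]
  simp

lemma nIdx_div {n : ℕ} (hn : 1 ≤ n) {y : ℝ} (hy : y ∈ Ioc (1 : ℝ) 2) :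
    nIdx (y / 2 ^ n) = n := by
  have hy0 : 0 < y := one_pos.trans hy.1
  have hfloor : ⌊Real.logb 2 (y / 2 ^ n)⁻¹⌋ = (n : ℤ) - 1 := by
    have hlog : Real.logb 2 (y / 2 ^ n)⁻¹ = n - Real.logb 2 y := by
      rw [inv_div, Real.logb_div (by positivity) hy0.ne', Real.logb_pow,
        Real.logb_self_eq_one one_lt_two, mul_one]
    have h1 : 0 < Real.logb 2 y := Real.logb_pos one_lt_two hy.1
    have h2 : Real.logb 2 y ≤ 1 := by
      rw [← Real.logb_self_eq_one (b := 2) one_lt_two]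
      exact Real.logb_le_logb_of_le one_lt_two hy0 hy.2
    rw [Int.floor_eq_iff, hlog]
    push_cast
    constructor <;> linarith
  rw [nIdx, hfloor]
  omega

/-- The conjugacy from the sawtooth map on `[0,1]` to the restriction of `f_a` to
`[2^{-n}, 2^{-n+1}]`. -/
noncomputable def faConj (a : ℝ) (n : ℕ) (x : Icc (0 : ℝ) 1) : ℝ := ((x : ℝ) ^ a + 1) / 2 ^ n

lemma fa_faConj {a : ℝ} (ha : 0 < a) {n : ℕ} (hn : 1 ≤ n) (x : Icc (0 : ℝ) 1) :
    fa a (faConj a n x) = (g1 (2 * n + 1) x ^ a + 1) / 2 ^ n := by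
  obtain ⟨x, hx⟩ := x
  have h2n : (0 : ℝ) < 2 ^ n := by positivity
  rcases hx.1.eq_or_lt with rfl | hx0
  · have hc : faConj a n ⟨0, hx⟩ = 2 / 2 ^ (n + 1) := by
      rw [faConj, Real.zero_rpow ha.ne', pow_succ]
      field_simp
      norm_num
    have hpos : ¬ (2 : ℝ) / 2 ^ (n + 1) ≤ 0 := not_le.2 (by positivity)
    have hg : gab a (2 * (n + 1) + 1) 1 = 1 := by
      rw [gab, Real.one_rpow, g1_one ⟨n + 1, rfl⟩, Real.one_rpow]
    rw [hc, fa, if_neg hpos, nIdx_div (by omega) ⟨one_lt_two, le_rfl⟩,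
      mul_div_cancel₀ _ (by positivity), show (2 : ℝ) - 1 = 1 by norm_num, hg,
      g1_zero (by omega), Real.zero_rpow ha.ne', pow_succ]
    field_simp
    norm_num
  · have hy : x ^ a + 1 ∈ Ioc (1 : ℝ) 2 :=
      ⟨by linarith [Real.rpow_pos_of_pos hx0 a], by linarith [Real.rpow_le_one hx.1 hx.2 ha.le]⟩
    have hpos : ¬ (x ^ a + 1) / (2 : ℝ) ^ n ≤ 0 :=
      not_le.2 (div_pos (by linarith [hy.1]) h2n)
    rw [faConj, fa, if_neg hpos, nIdx_div hn hy, mul_div_cancel₀ _ h2n.ne', add_sub_cancel_right,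
      gab_rpow ha _ hx.1]

lemma semiconj_faConj {a : ℝ} (ha : 0 < a) {n : ℕ} (hn : 1 ≤ n) :
    Function.Semiconj (faConj a n) ((mapsTo_g1 (2 * n + 1)).restrict _ _ _) (fa a) :=
  fun x ↦ (fa_faConj ha hn x).symm

lemma continuous_faConj {a : ℝ} (ha : 0 < a) (n : ℕ) : Continuous (faConj a n) := by
  unfold faConj
  have : Continuous fun x : Icc (0 : ℝ) 1 ↦ (x : ℝ) ^ a :=
    continuous_subtype_val.rpow_const fun _ ↦ .inr ha.le
  fun_prop

lemma faConj_injective {a : ℝ} (ha : 0 < a) (n : ℕ) : Function.Injective (faConj a n) := by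
  intro x y h
  have h1 : (x : ℝ) ^ a + 1 = (y : ℝ) ^ a + 1 := (div_left_inj' (by positivity)).1 h
  exact Subtype.ext ((Real.rpow_left_inj x.2.1 y.2.1 ha.ne').1 (add_right_cancel h1))

lemma range_faConj {a : ℝ} (ha : 0 < a) (n : ℕ) :
    range (faConj a n) = Icc ((2 : ℝ) ^ (-(n : ℤ))) ((2 : ℝ) ^ (-(n : ℤ) + 1)) := by
  have h2n : (0 : ℝ) < 2 ^ n := by positivity
  rw [zpow_add₀ two_ne_zero, zpow_neg, zpow_natCast, zpow_one, inv_mul_eq_div, ← one_div]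
  ext y
  rw [mem_Icc, div_le_iff₀ h2n, le_div_iff₀ h2n]
  constructor
  · rintro ⟨x, rfl⟩
    rw [faConj, div_mul_cancel₀ _ h2n.ne']
    exact ⟨by linarith [Real.rpow_nonneg x.2.1 a],
      by linarith [Real.rpow_le_one x.2.1 x.2.2 ha.le]⟩
  · rintro ⟨h1, h2⟩
    have h0 : 0 ≤ y * 2 ^ n - 1 := by linarith
    refine ⟨⟨(y * 2 ^ n - 1) ^ a⁻¹, Real.rpow_nonneg h0 _,
      Real.rpow_le_one h0 (by linarith) (inv_nonneg.2 ha.le)⟩, ?_⟩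
    rw [faConj, Real.rpow_inv_rpow h0 ha.ne', sub_add_cancel, mul_div_cancel_right₀ _ h2n.ne']

lemma mapsTo_fa {a : ℝ} (ha : 0 < a) {n : ℕ} (hn : 1 ≤ n) :
    MapsTo (fa a) (Icc ((2 : ℝ) ^ (-(n : ℤ))) ((2 : ℝ) ^ (-(n : ℤ) + 1)))
      (Icc ((2 : ℝ) ^ (-(n : ℤ))) ((2 : ℝ) ^ (-(n : ℤ) + 1))) := by
  rw [← range_faConj ha n]
  rintro _ ⟨x, rfl⟩
  exact ⟨_, semiconj_faConj ha hn x⟩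

open Dynamics in
/-- The entropy of a subset is preserved by a continuous injective semiconjugacy from a compact
space. -/
lemma coverEntropy_range_of_semiconj {X Y : Type*} [UniformSpace X] [CompactSpace X]
    [UniformSpace Y] [T2Space Y] {S : X → X} {T : Y → Y} {φ : X → Y}
    (h : Function.Semiconj φ S T) (hc : Continuous φ) (hi : Function.Injective φ) :
    coverEntropy T (range φ) = coverEntropy S univ := by
  rw [← image_univ, coverEntropy_image_of_comap _ h]
  congr 1
  exact unique_uniformity_of_compact (hc.isClosedEmbedding hi).isInducing.eq_induced.symm rfl

theorem coverEntropy_fa {a : ℝ} (ha : 0 < a) {n : ℕ} (hn : 1 ≤ n) :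
    Dynamics.coverEntropy (fa a) (Icc ((2 : ℝ) ^ (-(n : ℤ))) ((2 : ℝ) ^ (-(n : ℤ) + 1)))
      = (Real.log (2 * n + 1) : EReal) := by
  rw [← range_faConj ha n, coverEntropy_range_of_semiconj (semiconj_faConj ha hn)
    (continuous_faConj ha n) (faConj_injective ha n), Dynamics.coverEntropy_restrict,
    coverEntropy_g1 (by omega)]
  push_cast
  rfl

lemma exists_small_invariant_large_entropy {a : ℝ} (ha : 0 < a) {ε : ℝ} (hε : 0 < ε) (M : ℝ) :
    ∃ F : Set ℝ, F ⊆ Icc (0 : ℝ) 1 ∧ MapsTo (fa a) F F ∧ Metric.diam F ≤ ε ∧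
      (M : EReal) ≤ Dynamics.coverEntropy (fa a) F := by
  have h1 : ∀ᶠ n : ℕ in Filter.atTop, (2⁻¹ : ℝ) ^ n < ε :=
    (tendsto_pow_atTop_nhds_zero_of_lt_one (by norm_num) (by norm_num)).eventually_lt_const hε
  have h2 : ∀ᶠ n : ℕ in Filter.atTop, M ≤ Real.log n :=
    (Real.tendsto_log_atTop.comp tendsto_natCast_atTop_atTop).eventually_ge_atTop M
  obtain ⟨n, ⟨h1, h2⟩, hn⟩ := ((h1.and h2).and (Filter.eventually_ge_atTop 1)).exists
  have hn0 : (0 : ℝ) < n := by exact_mod_cast hn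
  have hpos : (0 : ℝ) < 2 ^ (-(n : ℤ)) := by positivity
  have hsucc : (2 : ℝ) ^ (-(n : ℤ) + 1) = 2 * 2 ^ (-(n : ℤ)) := by
    rw [zpow_add_one₀ two_ne_zero, mul_comm]
  refine ⟨_, Icc_subset_Icc hpos.le ?_, mapsTo_fa ha hn, ?_, ?_⟩
  · exact zpow_le_one_of_nonpos₀ one_le_two (by omega)
  · rw [Real.diam_Icc (by linarith), hsucc]
    rw [inv_pow, ← zpow_natCast, ← zpow_neg] at h1
    linarith
  · rw [coverEntropy_fa ha hn, EReal.coe_le_coe_iff]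
    exact h2.trans (Real.log_le_log hn0 (by linarith))

lemma not_asympHExpansive_fa {a : ℝ} (ha : 0 < a) : ¬ AsympHExpansive (fa a) := by
  intro h
  have hev := Filter.Tendsto.eventually_lt_const (v := (0 : EReal)) (u := 1) zero_lt_one h
  obtain ⟨ε, hlt, hε⟩ := (hev.and self_mem_nhdsWithin).exists
  obtain ⟨F, hF, hinv, hdiam, hent⟩ := exists_small_invariant_large_entropy ha hε 1
  have hne : F.Nonempty := by
    by_contra hne
    rw [not_nonempty_iff_eq_empty.1 hne, Dynamics.coverEntropy_empty, le_bot_iff] at hent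
    exact EReal.coe_ne_bot _ hent
  obtain ⟨x, hx⟩ := hne
  have hsub : F ⊆ {y ∈ Icc (0 : ℝ) 1 | ∀ n : ℕ, |(fa a)^[n] x - (fa a)^[n] y| ≤ ε} := by
    refine fun y hy ↦ ⟨hF hy, fun n ↦ ?_⟩
    rw [← Real.dist_eq]
    exact (Metric.dist_le_diam_of_mem ((Metric.isBounded_Icc 0 1).subset hF)
      (hinv.iterate n hx) (hinv.iterate n hy)).trans hdiam
  refine hlt.not_ge ?_
  calc (1 : EReal) ≤ _ := hent
    _ ≤ _ := Dynamics.coverEntropy_monotone (fa a) hsub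
    _ ≤ hStar (fa a) ε := le_iSup₂_of_le (f := fun x (_ : x ∈ Icc (0 : ℝ) 1) ↦
        Dynamics.coverEntropy (fa a)
          {y ∈ Icc (0 : ℝ) 1 | ∀ n : ℕ, |(fa a)^[n] x - (fa a)^[n] y| ≤ ε}) x (hF hx) le_rfl

/-- For every `a ∈ (0,1]` and every `n ≥ 1`, the interval `[2^{-n}, 2^{-n+1}]` is
`f_a`-invariant and the entropy of `f_a` restricted to it equals `log (2n+1)`.
In particular `f_a` has invariant sets of arbitrarily small diameter carrying
arbitrarily large entropy, so `f_a` is not asymptotically `h`-expansive. -/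
theorem fa_invariant_intervals_entropy (a : ℝ) (ha : a ∈ Set.Ioc (0 : ℝ) 1)
    (n : ℕ) (hn : 1 ≤ n) :
    Set.MapsTo (fa a) (Set.Icc ((2 : ℝ) ^ (-(n : ℤ))) ((2 : ℝ) ^ (-(n : ℤ) + 1)))
        (Set.Icc ((2 : ℝ) ^ (-(n : ℤ))) ((2 : ℝ) ^ (-(n : ℤ) + 1))) ∧
    Dynamics.coverEntropy (fa a)
        (Set.Icc ((2 : ℝ) ^ (-(n : ℤ))) ((2 : ℝ) ^ (-(n : ℤ) + 1)))
      = (Real.log (2 * n + 1) : EReal) ∧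
    (∀ ε > (0 : ℝ), ∀ M : ℝ, ∃ F : Set ℝ, F ⊆ Set.Icc (0 : ℝ) 1 ∧
      Set.MapsTo (fa a) F F ∧ Metric.diam F ≤ ε ∧
      (M : EReal) ≤ Dynamics.coverEntropy (fa a) F) ∧
    ¬ AsympHExpansive (fa a) := by
  exact ⟨mapsTo_fa ha.1 hn, coverEntropy_fa ha.1 hn,
    fun _ hε M ↦ exists_small_invariant_large_entropy ha.1 hε M, not_asympHExpansive_fa ha.1⟩
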